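/- Let l ≥ 1 be an integer, R, T > 0, and let a, b be real constants with a > 0 and b ≤ 0. Then there exists a constant c > 0, depending only on T, R, l, a, b, such that the following holds: for all smooth functions f, G₀, …, G_l : [0,T] × [0,R] → ℝ and every smooth u : [0,T] × [0,R] → ℝ satisfying ∂_t u − (−1)^l ( a ∂_x^{2l+1} u + b ∂_x^{2l} u ) = f + Σ_{j=0}^{l} (−1)^j ∂_x^j G_j on [0,T] × [0,R], with u(0,x) = 0 for all x ∈ [0,R], ∂_x^j u(t,0) = 0 for j = 0,…,l−1 and ∂_x^j u(t,R) = 0 for j = 0,…,l for all t ∈ [0,T], one has ‖u‖_{X(Q_T)} ≤ c ( ∫₀^T (∫₀^R f(t,x)² dx)^{1/2} dt + Σ_{j=0}^{l} ‖G_j‖_{L^{2l/(2l−j)}(0,T;L²(I))} ). -/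

import Mathlib

open MeasureTheory Set

/-- The norm of the space `X(Q_T)`. -/
noncomputable def XNorm (l : ℕ) (R T : ℝ) (v : ℝ → ℝ → ℝ) : ℝ :=
  (⨆ t ∈ Set.Icc (0:ℝ) T, Real.sqrt (∫ x in (0:ℝ)..R, (v t x) ^ 2)) +
  Real.sqrt (∫ t in (0:ℝ)..T, ∫ x in (0:ℝ)..R, (iteratedDeriv l (v t) x) ^ 2)

/-- The mixed norm `L^q(0,T;L²(0,R))`. -/
noncomputable def mixedNorm (q R T : ℝ) (F : ℝ → ℝ → ℝ) : ℝ :=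
  (∫ t in (0:ℝ)..T, (∫ x in (0:ℝ)..R, (F t x) ^ 2) ^ (q / 2)) ^ (1 / q)

/-- The norm of `L²(0,R)`. -/
noncomputable def l2Norm (R : ℝ) (g : ℝ → ℝ) : ℝ := Real.sqrt (∫ x in (0:ℝ)..R, g x ^ 2)

theorem l2Norm_nonneg (R : ℝ) (g : ℝ → ℝ) : 0 ≤ l2Norm R g := Real.sqrt_nonneg _

theorem sq_l2Norm {R : ℝ} (hR : 0 ≤ R) (g : ℝ → ℝ) :
    l2Norm R g ^ 2 = ∫ x in (0:ℝ)..R, g x ^ 2 :=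
  Real.sq_sqrt (intervalIntegral.integral_nonneg hR fun _ _ => sq_nonneg _)

theorem integral_mul_le_l2Norm_mul_l2Norm {R : ℝ} (hR : 0 ≤ R) {g h : ℝ → ℝ}
    (hg : Continuous g) (hh : Continuous h) :
    |∫ x in (0:ℝ)..R, g x * h x| ≤ l2Norm R g * l2Norm R h := by
  have key : ∀ s : ℝ, 0 ≤ (∫ x in (0:ℝ)..R, h x ^ 2) * (s * s) +
      (2 * ∫ x in (0:ℝ)..R, g x * h x) * s + ∫ x in (0:ℝ)..R, g x ^ 2 := by
    intro s
    have h1 : 0 ≤ ∫ x in (0:ℝ)..R, (g x + s * h x) ^ 2 :=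
      intervalIntegral.integral_nonneg hR fun _ _ => sq_nonneg _
    have h2 : ∫ x in (0:ℝ)..R, (g x + s * h x) ^ 2 =
        ∫ x in (0:ℝ)..R, ((s * s) * h x ^ 2 + (2 * s) * (g x * h x) + g x ^ 2) := by
      congr 1; ext x; ring
    rw [h2, intervalIntegral.integral_add (by apply Continuous.intervalIntegrable; fun_prop)
      (by apply Continuous.intervalIntegrable; fun_prop),
      intervalIntegral.integral_add (by apply Continuous.intervalIntegrable; fun_prop)
      (by apply Continuous.intervalIntegrable; fun_prop),
      intervalIntegral.integral_const_mul, intervalIntegral.integral_const_mul] at h1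
    linarith
  have hd := discrim_le_zero key
  rw [discrim, ← sq_l2Norm hR, ← sq_l2Norm hR] at hd
  refine abs_le_of_sq_le_sq ?_ (mul_nonneg (l2Norm_nonneg _ _) (l2Norm_nonneg _ _))
  nlinarith

theorem l2Norm_weight_mul_le {R : ℝ} (hR : 0 ≤ R) {g : ℝ → ℝ} (hg : Continuous g) :
    l2Norm R (fun x => (1 + x) * g x) ≤ (1 + R) * l2Norm R g := by
  refine abs_le_of_sq_le_sq' ?_ (by have := l2Norm_nonneg R g; positivity) |>.2
  rw [mul_pow, sq_l2Norm hR, sq_l2Norm hR, ← intervalIntegral.integral_const_mul]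
  refine intervalIntegral.integral_mono_on hR (by apply Continuous.intervalIntegrable; fun_prop)
    (by apply Continuous.intervalIntegrable; fun_prop) fun x hx => ?_
  rw [mul_pow]
  have := hx.1
  have := hx.2
  gcongr

theorem l2Norm_le_mul_l2Norm_deriv {R : ℝ} (hR : 0 ≤ R) {v v' : ℝ → ℝ}
    (hv : ∀ x, HasDerivAt v (v' x) x) (hv' : Continuous v') (h0 : v 0 = 0) :
    l2Norm R v ≤ R * l2Norm R v' := by
  have hvc : Continuous v := continuous_iff_continuousAt.2 fun x => (hv x).continuousAt
  have hpt : ∀ x ∈ Icc 0 R, v x ^ 2 ≤ R * l2Norm R v' ^ 2 := by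
    intro x hx
    have h1 : ∫ y in (0:ℝ)..x, 1 * v' y = v x := by
      simp only [one_mul]
      rw [intervalIntegral.integral_eq_sub_of_hasDerivAt (fun y _ => hv y)
        (hv'.intervalIntegrable _ _), h0, sub_zero]
    have h2 := integral_mul_le_l2Norm_mul_l2Norm hx.1 (continuous_const (y := (1:ℝ))) hv'
    rw [h1] at h2
    have h3 : v x ^ 2 ≤ (l2Norm x (fun _ => 1) * l2Norm x v') ^ 2 := by
      rw [← sq_abs]; gcongr
    rw [mul_pow, sq_l2Norm hx.1, sq_l2Norm hx.1] at h3
    rw [sq_l2Norm hR]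
    have h4 : ∫ y in (0:ℝ)..x, v' y ^ 2 ≤ ∫ y in (0:ℝ)..R, v' y ^ 2 :=
      intervalIntegral.integral_mono_interval le_rfl hx.1 hx.2
        (Filter.Eventually.of_forall fun _ => sq_nonneg _)
        (by apply Continuous.intervalIntegrable; fun_prop)
    refine h3.trans (mul_le_mul ?_ h4 (intervalIntegral.integral_nonneg hx.1
      fun _ _ => sq_nonneg _) hR)
    simpa using hx.2
  refine abs_le_of_sq_le_sq' ?_ (by have := l2Norm_nonneg R v'; positivity) |>.2
  rw [sq_l2Norm hR]
  calc ∫ x in (0:ℝ)..R, v x ^ 2 ≤ ∫ _ in (0:ℝ)..R, R * l2Norm R v' ^ 2 :=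
        intervalIntegral.integral_mono_on hR (by apply Continuous.intervalIntegrable; fun_prop)
          (by apply Continuous.intervalIntegrable; fun_prop) hpt
    _ = (R * l2Norm R v') ^ 2 := by
        rw [intervalIntegral.integral_const, smul_eq_mul]; ring

theorem pow_succ_le_of_logConvex {l : ℕ} {n : ℕ → ℝ} (hn : ∀ j, 0 ≤ n j)
    (hc : ∀ j, j + 2 ≤ l → n (j + 1) ^ 2 ≤ n j * n (j + 2)) (m : ℕ) (hm : m + 1 ≤ l) :
    n m ^ (m + 1) ≤ n 0 * n (m + 1) ^ m := by
  induction m with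
  | zero => simp
  | succ m ih =>
    have ih := ih (by omega)
    rcases (hn (m + 1)).eq_or_lt with h0 | h0
    · rw [← h0, zero_pow (by omega)]
      exact mul_nonneg (hn _) (pow_nonneg (hn _) _)
    · have h1 : (n (m + 1) ^ 2) ^ (m + 1) ≤ (n m * n (m + 2)) ^ (m + 1) :=
        pow_le_pow_left₀ (sq_nonneg _) (hc m hm) _
      rw [mul_pow] at h1
      have h2 := h1.trans (mul_le_mul_of_nonneg_right ih (pow_nonneg (hn (m + 2)) (m + 1)))
      have h3 : n (m + 1) ^ m * n (m + 1) ^ (m + 1 + 1) ≤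
          n (m + 1) ^ m * (n 0 * n (m + 2) ^ (m + 1)) := by
        calc _ = (n (m + 1) ^ 2) ^ (m + 1) := by ring
          _ ≤ _ := h2
          _ = _ := by ring
      exact le_of_mul_le_mul_left h3 (pow_pos h0 _)

theorem le_rpow_mul_rpow_of_logConvex {l : ℕ} {n : ℕ → ℝ} (hn : ∀ j, 0 ≤ n j)
    (hc : ∀ j, j + 2 ≤ l → n (j + 1) ^ 2 ≤ n j * n (j + 2)) {j : ℕ} (hj : j ≤ l) (hl : 1 ≤ l) :
    n j ≤ n 0 ^ (1 - (j : ℝ) / l) * n l ^ ((j : ℝ) / l) := by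
  suffices H : ∀ k, 1 ≤ k → j ≤ k → k ≤ l →
      n j ≤ n 0 ^ (1 - (j : ℝ) / k) * n k ^ ((j : ℝ) / k) from H l hl hj le_rfl
  intro k hk hjk
  rcases Nat.eq_zero_or_pos j with rfl | hj0
  · intro _; simp
  induction k, hjk using Nat.le_induction with
  | base =>
    intro _
    have : (j : ℝ) ≠ 0 := by positivity
    simp [this]
  | succ k hjk ih =>
    intro hkl
    have hk0 : (0 : ℝ) < k := by exact_mod_cast lt_of_lt_of_le hj0 hjk
    have hjk' : (j : ℝ) ≤ k := by exact_mod_cast hjk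
    have ih := ih (by omega) (by omega)
    have h1 := pow_succ_le_of_logConvex hn hc k hkl
    have h2 : n k ^ ((j : ℝ) / k) ≤
        n 0 ^ ((j : ℝ) / (k * (k + 1))) * n (k + 1) ^ ((j : ℝ) / (k + 1)) := by
      calc n k ^ ((j : ℝ) / k) = (n k ^ (k + 1)) ^ ((j : ℝ) / (k * (k + 1))) := by
            rw [← Real.rpow_natCast, ← Real.rpow_mul (hn k)]
            congr 1; push_cast; field_simp
        _ ≤ (n 0 * n (k + 1) ^ k) ^ ((j : ℝ) / (k * (k + 1))) :=
            Real.rpow_le_rpow (pow_nonneg (hn k) _) h1 (by positivity)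
        _ = _ := by
            rw [Real.mul_rpow (hn 0) (pow_nonneg (hn _) _), ← Real.rpow_natCast,
              ← Real.rpow_mul (hn _)]
            congr 2; field_simp
    refine ih.trans ((mul_le_mul_of_nonneg_left h2 (Real.rpow_nonneg (hn 0) _)).trans_eq ?_)
    rw [← mul_assoc, ← Real.rpow_add_of_nonneg (hn 0) _ (by positivity)]
    · push_cast
      congr 2; field_simp; ring
    · rw [sub_nonneg, div_le_one hk0]; exact hjk'

theorem ContDiff.hasDerivAt_iteratedDeriv {v : ℝ → ℝ} (hv : ContDiff ℝ (⊤ : ℕ∞) v)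
    (j : ℕ) (x : ℝ) : HasDerivAt (iteratedDeriv j v) (iteratedDeriv (j + 1) v x) x := by
  rw [iteratedDeriv_succ]
  exact (hv.differentiable_iteratedDeriv j
    (by exact_mod_cast WithTop.coe_lt_top (j : ℕ)) x).hasDerivAt

theorem ContDiff.continuous_iteratedDeriv_infty {v : ℝ → ℝ} (hv : ContDiff ℝ (⊤ : ℕ∞) v)
    (j : ℕ) : Continuous (iteratedDeriv j v) :=
  continuous_iff_continuousAt.2 fun x => (hv.hasDerivAt_iteratedDeriv j x).continuousAt

theorem l2Norm_iteratedDeriv_interpolation {R : ℝ} (hR : 0 ≤ R) {l : ℕ} (hl : 1 ≤ l) {v : ℝ → ℝ}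
    (hv : ContDiff ℝ (⊤ : ℕ∞) v) (h0 : ∀ i < l, iteratedDeriv i v 0 = 0)
    (h1 : ∀ i < l, iteratedDeriv i v R = 0) {j : ℕ} (hj : j ≤ l) :
    l2Norm R (iteratedDeriv j v) ≤
      l2Norm R v ^ (1 - (j : ℝ) / l) * l2Norm R (iteratedDeriv l v) ^ ((j : ℝ) / l) := by
  have hc := hv.continuous_iteratedDeriv_infty
  have := le_rpow_mul_rpow_of_logConvex (n := fun i => l2Norm R (iteratedDeriv i v))
    (fun _ => l2Norm_nonneg _ _) (l := l) ?_ hj hl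
  · simpa using this
  intro i hi
  have h2 : ∫ x in (0:ℝ)..R, iteratedDeriv i v x * iteratedDeriv (i + 2) v x =
      - ∫ x in (0:ℝ)..R, iteratedDeriv (i + 1) v x ^ 2 := by
    rw [intervalIntegral.integral_mul_deriv_eq_deriv_mul
      (fun x _ => hv.hasDerivAt_iteratedDeriv i x) (fun x _ => hv.hasDerivAt_iteratedDeriv (i + 1) x)
      ((hc _).intervalIntegrable _ _) ((hc _).intervalIntegrable _ _),
      h0 i (by omega), h1 i (by omega)]
    simp [sq]
  have h3 := integral_mul_le_l2Norm_mul_l2Norm hR (hc i) (hc (i + 2))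
  rw [h2, abs_neg, ← sq_l2Norm hR, abs_of_nonneg (sq_nonneg _)] at h3
  exact h3

theorem integral_iteratedDeriv_mul {R : ℝ} {g v : ℝ → ℝ} (hg : ContDiff ℝ (⊤ : ℕ∞) g)
    (hv : ContDiff ℝ (⊤ : ℕ∞) v) (j : ℕ) (h0 : ∀ i < j, iteratedDeriv i v 0 = 0)
    (h1 : ∀ i < j, iteratedDeriv i v R = 0) :
    ∫ x in (0:ℝ)..R, iteratedDeriv j g x * v x =
      (-1) ^ j * ∫ x in (0:ℝ)..R, g x * iteratedDeriv j v x := by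
  induction j generalizing v with
  | zero => simp
  | succ j ih =>
    have hv' : ContDiff ℝ (⊤ : ℕ∞) (deriv v) := (contDiff_infty_iff_deriv.1 hv).2
    have ih := ih hv' (fun i hi => by rw [← iteratedDeriv_succ']; exact h0 _ (by omega))
      (fun i hi => by rw [← iteratedDeriv_succ']; exact h1 _ (by omega))
    have e0 : v 0 = 0 := by simpa using h0 0 (by omega)
    have e1 : v R = 0 := by simpa using h1 0 (by omega)
    have hd : ∀ x, HasDerivAt v (deriv v x) x :=
      fun x => ((contDiff_infty_iff_deriv.1 hv).1 x).hasDerivAt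
    have hparts := intervalIntegral.integral_mul_deriv_eq_deriv_mul (a := 0) (b := R)
      (fun x _ => hg.hasDerivAt_iteratedDeriv j x) (fun x _ => hd x)
      ((hg.continuous_iteratedDeriv_infty _).intervalIntegrable _ _)
      (hv'.continuous.intervalIntegrable _ _)
    rw [e0, e1, ih] at hparts
    rw [iteratedDeriv_succ' (f := v), pow_succ]
    linarith

theorem iteratedDeriv_weight_mul {v : ℝ → ℝ} (hv : ContDiff ℝ (⊤ : ℕ∞) v) (j : ℕ) :
    iteratedDeriv j (fun x => (1 + x) * v x) =
      fun x => (1 + x) * iteratedDeriv j v x + j * iteratedDeriv (j - 1) v x := by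
  induction j with
  | zero => simp
  | succ j ih =>
    rw [iteratedDeriv_succ, ih]
    ext x
    have hx : HasDerivAt (fun y : ℝ => 1 + y) 1 x := (hasDerivAt_id x).const_add 1
    have h := (hx.mul (hv.hasDerivAt_iteratedDeriv j x)).add
      ((hv.hasDerivAt_iteratedDeriv (j - 1) x).const_mul (j : ℝ))
    refine h.deriv.trans ?_
    rcases j with _ | j
    · simp; ring
    · simp only [Nat.add_sub_cancel]; push_cast; ring

theorem integral_iteratedDeriv_mul_weight {R : ℝ} {g v : ℝ → ℝ} (hg : ContDiff ℝ (⊤ : ℕ∞) g)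
    (hv : ContDiff ℝ (⊤ : ℕ∞) v) (j : ℕ) (h0 : ∀ i < j, iteratedDeriv i v 0 = 0)
    (h1 : ∀ i < j, iteratedDeriv i v R = 0) :
    ∫ x in (0:ℝ)..R, iteratedDeriv j g x * ((1 + x) * v x) =
      (-1) ^ j * ∫ x in (0:ℝ)..R,
        g x * ((1 + x) * iteratedDeriv j v x + j * iteratedDeriv (j - 1) v x) := by
  rw [integral_iteratedDeriv_mul hg (v := fun x => (1 + x) * v x) (by fun_prop) j]
  · rw [iteratedDeriv_weight_mul hv]
  all_goals
    intro i hi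
    simp only [iteratedDeriv_weight_mul hv]
    first
    | rw [h0 i hi, h0 (i - 1) (by omega)]
    | rw [h1 i hi, h1 (i - 1) (by omega)]
    simp

theorem iteratedDeriv_iteratedDeriv_eq (m n : ℕ) (v : ℝ → ℝ) :
    iteratedDeriv m (iteratedDeriv n v) = iteratedDeriv (m + n) v := by
  simp only [iteratedDeriv_eq_iterate, Function.iterate_add_apply]

theorem ContDiff.iteratedDeriv_infty {v : ℝ → ℝ} (hv : ContDiff ℝ (⊤ : ℕ∞) v) (n : ℕ) :
    ContDiff ℝ (⊤ : ℕ∞) (iteratedDeriv n v) := by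
  rw [iteratedDeriv_eq_iterate]; exact hv.iterate_deriv n

theorem dissipation_odd {R : ℝ} {l : ℕ} (hl : 1 ≤ l) {v : ℝ → ℝ}
    (hv : ContDiff ℝ (⊤ : ℕ∞) v) (h0 : ∀ i < l, iteratedDeriv i v 0 = 0)
    (h1 : ∀ i ≤ l, iteratedDeriv i v R = 0) :
    (-1) ^ l * ∫ x in (0:ℝ)..R, iteratedDeriv (2 * l + 1) v x * ((1 + x) * v x) ≤
      - (l + 1 / 2) * ∫ x in (0:ℝ)..R, iteratedDeriv l v x ^ 2 := by
  have hc := hv.continuous_iteratedDeriv_infty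
  obtain ⟨k, rfl⟩ : ∃ k, l = k + 1 := ⟨l - 1, by omega⟩
  have e : 2 * (k + 1) + 1 = (k + 1) + (k + 2) := by ring
  rw [e, ← iteratedDeriv_iteratedDeriv_eq, integral_iteratedDeriv_mul_weight
    (hv.iteratedDeriv_infty _) hv _ h0 (fun i hi => h1 i hi.le), ← mul_assoc, ← mul_pow]
  simp only [mul_neg, mul_one, neg_neg, one_pow, one_mul, Nat.add_sub_cancel]
  have hd : ∀ x, HasDerivAt (fun x => (1 + x) * iteratedDeriv (k + 1) v x ^ 2 / 2 +
      (k + 1) * (iteratedDeriv (k + 1) v x * iteratedDeriv k v x))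
      (iteratedDeriv (k + 2) v x * ((1 + x) * iteratedDeriv (k + 1) v x +
        ((k + 1 : ℕ) : ℝ) * iteratedDeriv k v x) +
        (((k + 1 : ℕ) : ℝ) + 1 / 2) * iteratedDeriv (k + 1) v x ^ 2) x := by
    intro x
    have hx : HasDerivAt (fun y : ℝ => 1 + y) 1 x := (hasDerivAt_id x).const_add 1
    have d0 := hv.hasDerivAt_iteratedDeriv k x
    have d1 := hv.hasDerivAt_iteratedDeriv (k + 1) x
    refine (((hx.mul (d1.pow 2)).div_const 2).add
      ((d1.mul d0).const_mul ((k : ℝ) + 1))).congr_deriv ?_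
    simp only [Pi.pow_apply]
    push_cast
    ring
  have hI := intervalIntegral.integral_eq_sub_of_hasDerivAt (a := 0) (b := R) (fun x _ => hd x)
    (by
      have := hc k
      have := hc (k + 1)
      have := hc (k + 2)
      apply Continuous.intervalIntegrable; fun_prop)
  rw [intervalIntegral.integral_add
    (by
      have := hc k
      have := hc (k + 1)
      have := hc (k + 2)
      apply Continuous.intervalIntegrable; fun_prop)
    (by have := hc (k + 1); apply Continuous.intervalIntegrable; fun_prop),
    intervalIntegral.integral_const_mul, h0 k (by omega), h1 (k + 1) le_rfl] at hI
  have := sq_nonneg (iteratedDeriv (k + 1) v 0)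
  linarith

theorem dissipation_even {R : ℝ} (hR : 0 ≤ R) {l : ℕ} (hl : 1 ≤ l) {v : ℝ → ℝ}
    (hv : ContDiff ℝ (⊤ : ℕ∞) v) (h0 : ∀ i < l, iteratedDeriv i v 0 = 0)
    (h1 : ∀ i ≤ l, iteratedDeriv i v R = 0) :
    0 ≤ (-1) ^ l * ∫ x in (0:ℝ)..R, iteratedDeriv (2 * l) v x * ((1 + x) * v x) := by
  have hc := hv.continuous_iteratedDeriv_infty
  obtain ⟨k, rfl⟩ : ∃ k, l = k + 1 := ⟨l - 1, by omega⟩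
  rw [two_mul, ← iteratedDeriv_iteratedDeriv_eq, integral_iteratedDeriv_mul_weight
    (hv.iteratedDeriv_infty _) hv _ h0 (fun i hi => h1 i hi.le), ← mul_assoc, ← mul_pow]
  simp only [mul_neg, mul_one, neg_neg, one_pow, one_mul, Nat.add_sub_cancel]
  have hd : ∀ x, HasDerivAt (fun x => ((k + 1 : ℕ) : ℝ) * iteratedDeriv k v x ^ 2 / 2)
      (((k + 1 : ℕ) : ℝ) * (iteratedDeriv (k + 1) v x * iteratedDeriv k v x)) x := by
    intro x
    refine ((((hv.hasDerivAt_iteratedDeriv k x).pow 2).const_mul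
      ((k + 1 : ℕ) : ℝ)).div_const 2).congr_deriv ?_
    push_cast
    ring
  have hck := hc k
  have hck' := hc (k + 1)
  have hI := intervalIntegral.integral_eq_sub_of_hasDerivAt (a := 0) (b := R) (fun x _ => hd x)
    (by apply Continuous.intervalIntegrable; fun_prop)
  have hs : ∫ x in (0:ℝ)..R, iteratedDeriv (k + 1) v x * ((1 + x) * iteratedDeriv (k + 1) v x +
      ((k + 1 : ℕ) : ℝ) * iteratedDeriv k v x) =
      (∫ x in (0:ℝ)..R, (1 + x) * iteratedDeriv (k + 1) v x ^ 2) +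
      ∫ x in (0:ℝ)..R, ((k + 1 : ℕ) : ℝ) * (iteratedDeriv (k + 1) v x * iteratedDeriv k v x) := by
    rw [← intervalIntegral.integral_add (by apply Continuous.intervalIntegrable; fun_prop)
      (by apply Continuous.intervalIntegrable; fun_prop)]
    congr 1; ext x; ring
  rw [hs, hI, h0 k (by omega), h1 k (by omega)]
  have : 0 ≤ ∫ x in (0:ℝ)..R, (1 + x) * iteratedDeriv (k + 1) v x ^ 2 :=
    intervalIntegral.integral_nonneg hR fun x hx => by have := hx.1; positivity
  simpa using this

theorem abs_integral_mul_weight_le {R : ℝ} (hR : 0 ≤ R) {l : ℕ} (hl : 1 ≤ l) {g v : ℝ → ℝ}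
    (hg : Continuous g) (hv : ContDiff ℝ (⊤ : ℕ∞) v) (h0 : ∀ i < l, iteratedDeriv i v 0 = 0)
    (h1 : ∀ i < l, iteratedDeriv i v R = 0) {j : ℕ} (hj : j ≤ l) :
    |∫ x in (0:ℝ)..R, g x * ((1 + x) * iteratedDeriv j v x + j * iteratedDeriv (j - 1) v x)| ≤
      (1 + R + l * R) * (l2Norm R g *
        (l2Norm R v ^ (1 - (j : ℝ) / l) * l2Norm R (iteratedDeriv l v) ^ ((j : ℝ) / l))) := by
  have hc := hv.continuous_iteratedDeriv_infty j
  have hc' := hv.continuous_iteratedDeriv_infty (j - 1)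
  have hN := l2Norm_nonneg R (iteratedDeriv j v)
  have hs : ∫ x in (0:ℝ)..R,
      g x * ((1 + x) * iteratedDeriv j v x + j * iteratedDeriv (j - 1) v x) =
      (∫ x in (0:ℝ)..R, g x * ((1 + x) * iteratedDeriv j v x)) +
      j * ∫ x in (0:ℝ)..R, g x * iteratedDeriv (j - 1) v x := by
    rw [← intervalIntegral.integral_const_mul,
      ← intervalIntegral.integral_add (by apply Continuous.intervalIntegrable; fun_prop)
      (by apply Continuous.intervalIntegrable; fun_prop)]
    congr 1; ext x; ring
  have hP : (j : ℝ) * l2Norm R (iteratedDeriv (j - 1) v) ≤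
      l * R * l2Norm R (iteratedDeriv j v) := by
    rcases j with _ | j
    · simpa using mul_nonneg (mul_nonneg l.cast_nonneg hR) hN
    · have := l2Norm_le_mul_l2Norm_deriv hR (hv.hasDerivAt_iteratedDeriv j) hc (h0 j (by omega))
      simp only [Nat.add_sub_cancel]
      rw [mul_assoc]
      have hjl : ((j + 1 : ℕ) : ℝ) ≤ l := by exact_mod_cast hj
      exact mul_le_mul hjl this (l2Norm_nonneg _ _) l.cast_nonneg
  rw [hs]
  have hG := l2Norm_nonneg R g
  calc _ ≤ l2Norm R g * l2Norm R (fun x => (1 + x) * iteratedDeriv j v x) +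
        j * (l2Norm R g * l2Norm R (iteratedDeriv (j - 1) v)) := by
        refine (abs_add_le _ _).trans (add_le_add
          (integral_mul_le_l2Norm_mul_l2Norm hR hg (by fun_prop)) ?_)
        rw [abs_mul, Nat.abs_cast]
        exact mul_le_mul_of_nonneg_left (integral_mul_le_l2Norm_mul_l2Norm hR hg hc')
          j.cast_nonneg
    _ ≤ l2Norm R g * ((1 + R) * l2Norm R (iteratedDeriv j v)) +
        l2Norm R g * (l * R * l2Norm R (iteratedDeriv j v)) := by
        refine add_le_add (mul_le_mul_of_nonneg_left (l2Norm_weight_mul_le hR hc) hG) ?_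
        rw [mul_left_comm]
        exact mul_le_mul_of_nonneg_left hP hG
    _ = (1 + R + l * R) * (l2Norm R g * l2Norm R (iteratedDeriv j v)) := by ring
    _ ≤ _ := by
        gcongr
        exact l2Norm_iteratedDeriv_interpolation hR hl hv h0 h1 hj

theorem spatial_energy_inequality {R : ℝ} (hR : 0 ≤ R) {l : ℕ} (hl : 1 ≤ l) {a b : ℝ}
    (ha : 0 ≤ a) (hb : b ≤ 0) {v w f : ℝ → ℝ} {G : ℕ → ℝ → ℝ} (hf : Continuous f)
    (hG : ∀ j ≤ l, ContDiff ℝ (⊤ : ℕ∞) (G j)) (hv : ContDiff ℝ (⊤ : ℕ∞) v)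
    (heq : ∀ x ∈ Icc 0 R, w x -
        (-1 : ℝ) ^ l * (a * iteratedDeriv (2 * l + 1) v x + b * iteratedDeriv (2 * l) v x) =
      f x + ∑ j ∈ Finset.range (l + 1), (-1 : ℝ) ^ j * iteratedDeriv j (G j) x)
    (h0 : ∀ i < l, iteratedDeriv i v 0 = 0) (h1 : ∀ i ≤ l, iteratedDeriv i v R = 0) :
    (∫ x in (0:ℝ)..R, (1 + x) * (2 * v x * w x)) + a * l2Norm R (iteratedDeriv l v) ^ 2 ≤
      2 * (1 + R + l * R) * (l2Norm R f * l2Norm R v + ∑ j ∈ Finset.range (l + 1),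
        l2Norm R (G j) *
          (l2Norm R v ^ (1 - (j : ℝ) / l) * l2Norm R (iteratedDeriv l v) ^ ((j : ℝ) / l))) := by
  have hc := hv.continuous_iteratedDeriv_infty
  have hc1 := hc (2 * l + 1)
  have hc2 := hc (2 * l)
  have hvc := hv.continuous
  have hGc : ∀ j ∈ Finset.range (l + 1), Continuous (iteratedDeriv j (G j)) := fun j hj =>
    (hG j (by simpa [Nat.lt_succ_iff] using hj)).continuous_iteratedDeriv_infty j
  have hexp : ∫ x in (0:ℝ)..R, (1 + x) * (2 * v x * w x) =
      2 * (a * ((-1) ^ l * ∫ x in (0:ℝ)..R, iteratedDeriv (2 * l + 1) v x * ((1 + x) * v x)) +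
        b * ((-1) ^ l * ∫ x in (0:ℝ)..R, iteratedDeriv (2 * l) v x * ((1 + x) * v x)) +
        (∫ x in (0:ℝ)..R, f x * ((1 + x) * v x)) +
        ∑ j ∈ Finset.range (l + 1), (-1) ^ j *
          ∫ x in (0:ℝ)..R, iteratedDeriv j (G j) x * ((1 + x) * v x)) := by
    simp only [← intervalIntegral.integral_const_mul]
    rw [← intervalIntegral.integral_finsetSum, ← intervalIntegral.integral_add,
      ← intervalIntegral.integral_add, ← intervalIntegral.integral_add,
      ← intervalIntegral.integral_const_mul]
    · refine intervalIntegral.integral_congr fun x hx => ?_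
      rw [uIcc_of_le hR] at hx
      have h := heq x hx
      rw [sub_eq_iff_eq_add] at h
      simp only [h]
      have hsum : ∑ j ∈ Finset.range (l + 1), (-1 : ℝ) ^ j *
          (iteratedDeriv j (G j) x * ((1 + x) * v x)) =
          (∑ j ∈ Finset.range (l + 1), (-1 : ℝ) ^ j * iteratedDeriv j (G j) x) *
            ((1 + x) * v x) := by
        rw [Finset.sum_mul]; exact Finset.sum_congr rfl fun _ _ => by ring
      rw [hsum]
      ring
    all_goals
      try intro j hj
      try have hj := hGc j hj
      apply Continuous.intervalIntegrable
      fun_prop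
  have hodd := mul_le_mul_of_nonneg_left (dissipation_odd hl hv h0 h1) ha
  have heven := mul_nonpos_of_nonpos_of_nonneg hb (dissipation_even hR hl hv h0 h1)
  have hF : ∫ x in (0:ℝ)..R, f x * ((1 + x) * v x) ≤
      (1 + R + l * R) * (l2Norm R f * l2Norm R v) := by
    have := abs_integral_mul_weight_le hR hl hf hv h0 (fun i hi => h1 i hi.le) (Nat.zero_le l)
    simp only [iteratedDeriv_zero, Nat.cast_zero, zero_mul, add_zero, zero_div, sub_zero,
      Real.rpow_one, Real.rpow_zero, mul_one] at this
    exact (le_abs_self _).trans this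
  have hS : ∑ j ∈ Finset.range (l + 1), (-1) ^ j *
      ∫ x in (0:ℝ)..R, iteratedDeriv j (G j) x * ((1 + x) * v x) ≤
      (1 + R + l * R) * ∑ j ∈ Finset.range (l + 1), l2Norm R (G j) *
        (l2Norm R v ^ (1 - (j : ℝ) / l) * l2Norm R (iteratedDeriv l v) ^ ((j : ℝ) / l)) := by
    rw [Finset.mul_sum]
    refine Finset.sum_le_sum fun j hj => ?_
    have hj : j ≤ l := by simpa [Nat.lt_succ_iff] using hj
    rw [integral_iteratedDeriv_mul_weight (hG j hj) hv j (fun i hi => h0 i (by omega))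
      (fun i hi => h1 i (by omega)), ← mul_assoc, ← mul_pow]
    simp only [mul_neg, mul_one, neg_neg, one_pow, one_mul]
    exact (le_abs_self _).trans (abs_integral_mul_weight_le hR hl (hG j hj).continuous hv h0
      (fun i hi => h1 i hi.le) hj)
  rw [hexp, sq_l2Norm hR]
  have hl0 : (0 : ℝ) ≤ l := l.cast_nonneg
  have hI : 0 ≤ a * ((l : ℝ) * ∫ x in (0:ℝ)..R, iteratedDeriv l v x ^ 2) := by
    rw [← sq_l2Norm hR]; positivity
  nlinarith

theorem hasDerivAt_snd_of_contDiff {U : ℝ → ℝ → ℝ}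
    (hU : ContDiff ℝ (⊤ : ℕ∞) fun p : ℝ × ℝ => U p.1 p.2) (t x : ℝ) :
    HasDerivAt (U t) (fderiv ℝ (fun p : ℝ × ℝ => U p.1 p.2) (t, x) (0, 1)) x :=
  ((hU.differentiable (by simp)) (t, x)).hasFDerivAt.comp_hasDerivAt x
    ((hasDerivAt_const x t).prodMk (hasDerivAt_id x))

theorem hasDerivAt_fst_of_contDiff {U : ℝ → ℝ → ℝ}
    (hU : ContDiff ℝ (⊤ : ℕ∞) fun p : ℝ × ℝ => U p.1 p.2) (t x : ℝ) :
    HasDerivAt (fun s => U s x) (fderiv ℝ (fun p : ℝ × ℝ => U p.1 p.2) (t, x) (1, 0)) t :=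
  ((hU.differentiable (by simp)) (t, x)).hasFDerivAt.comp_hasDerivAt t
    (f := fun s => (s, x)) ((hasDerivAt_id t).prodMk (hasDerivAt_const t x))

theorem contDiff_fderiv_apply {U : ℝ × ℝ → ℝ} (hU : ContDiff ℝ (⊤ : ℕ∞) U) (y : ℝ × ℝ) :
    ContDiff ℝ (⊤ : ℕ∞) fun p => fderiv ℝ U p y :=
  (hU.fderiv_right (m := (⊤ : ℕ∞)) (by simp)).clm_apply contDiff_const

theorem contDiff_iteratedDeriv_snd {U : ℝ → ℝ → ℝ}
    (hU : ContDiff ℝ (⊤ : ℕ∞) fun p : ℝ × ℝ => U p.1 p.2) (j : ℕ) :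
    ContDiff ℝ (⊤ : ℕ∞) fun p : ℝ × ℝ => iteratedDeriv j (U p.1) p.2 := by
  induction j with
  | zero => simpa using hU
  | succ j ih =>
    simp only [iteratedDeriv_succ]
    have e : (fun p : ℝ × ℝ => deriv (iteratedDeriv j (U p.1)) p.2) = fun p =>
        fderiv ℝ (fun p : ℝ × ℝ => iteratedDeriv j (U p.1) p.2) p (0, 1) := funext fun p =>
      (hasDerivAt_snd_of_contDiff (U := fun t x => iteratedDeriv j (U t) x) ih p.1 p.2).deriv
    rw [e]
    exact contDiff_fderiv_apply ih (0, 1)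

theorem contDiff_deriv_fst {U : ℝ → ℝ → ℝ}
    (hU : ContDiff ℝ (⊤ : ℕ∞) fun p : ℝ × ℝ => U p.1 p.2) :
    ContDiff ℝ (⊤ : ℕ∞) fun p : ℝ × ℝ => deriv (fun s => U s p.2) p.1 := by
  have e : (fun p : ℝ × ℝ => deriv (fun s => U s p.2) p.1) = fun p =>
      fderiv ℝ (fun p : ℝ × ℝ => U p.1 p.2) p (1, 0) :=
    funext fun p => (hasDerivAt_fst_of_contDiff hU p.1 p.2).deriv
  rw [e]
  exact contDiff_fderiv_apply hU (1, 0)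

theorem contDiff_slice {U : ℝ → ℝ → ℝ}
    (hU : ContDiff ℝ (⊤ : ℕ∞) fun p : ℝ × ℝ => U p.1 p.2) (t : ℝ) :
    ContDiff ℝ (⊤ : ℕ∞) (U t) :=
  hU.comp (contDiff_const.prodMk contDiff_id)

theorem continuous_l2Norm {R : ℝ} {W : ℝ → ℝ → ℝ}
    (hW : Continuous fun p : ℝ × ℝ => W p.1 p.2) : Continuous fun t => l2Norm R (W t) := by
  refine Real.continuous_sqrt.comp
    (intervalIntegral.continuous_parametric_intervalIntegral_of_continuous'
      (f := fun t x => W t x ^ 2) ?_ 0 R)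
  exact hW.pow 2

theorem integral_integral_weight_mul_deriv {R t : ℝ} (hR : 0 ≤ R) {u : ℝ → ℝ → ℝ}
    (hu : ContDiff ℝ (⊤ : ℕ∞) fun p : ℝ × ℝ => u p.1 p.2) (h0 : ∀ x ∈ Icc 0 R, u 0 x = 0) :
    ∫ s in (0:ℝ)..t, ∫ x in (0:ℝ)..R, (1 + x) * (2 * u s x * deriv (fun r => u r x) s) =
      ∫ x in (0:ℝ)..R, (1 + x) * u t x ^ 2 := by
  have hd := (contDiff_deriv_fst hu).continuous
  have huc := hu.continuous
  rw [intervalIntegral_intervalIntegral_swap]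
  · refine intervalIntegral.integral_congr fun x hx => ?_
    rw [uIcc_of_le hR] at hx
    have hux : ∀ s, HasDerivAt (fun r => (1 + x) * u r x ^ 2)
        ((1 + x) * (2 * u s x * deriv (fun r => u r x) s)) s := by
      intro s
      have h := (hasDerivAt_fst_of_contDiff hu s x).differentiableAt.hasDerivAt
      simpa using (h.pow 2).const_mul (1 + x)
    rw [intervalIntegral.integral_eq_sub_of_hasDerivAt (fun s _ => hux s), h0 x hx]
    · simp
    · apply Continuous.intervalIntegrable
      have h1 : Continuous fun s => u s x := huc.comp (by fun_prop : Continuous fun s => (s, x))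
      have h2 : Continuous fun s => deriv (fun r => u r x) s :=
        hd.comp (by fun_prop : Continuous fun s => (s, x))
      fun_prop
  · have hc : Continuous (Function.uncurry fun s x =>
        (1 + x) * (2 * u s x * deriv (fun r => u r x) s)) := by
      change Continuous fun p : ℝ × ℝ =>
        (1 + p.2) * (2 * u p.1 p.2 * deriv (fun r => u r p.2) p.1)
      fun_prop
    exact (hc.continuousOn.integrableOn_compact (isCompact_uIcc.prod isCompact_uIcc)).mono_set
      (prod_mono uIoc_subset_uIcc uIoc_subset_uIcc)

theorem Continuous.memLp_restrict_Ioc {g : ℝ → ℝ} (hg : Continuous g) (p : ENNReal) (c d : ℝ) :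
    MemLp g p (volume.restrict (Ioc c d)) := by
  obtain ⟨C, hC⟩ := (isCompact_Icc (a := c) (b := d)).exists_bound_of_continuousOn hg.continuousOn
  refine MemLp.of_bound hg.aestronglyMeasurable C ?_
  filter_upwards [ae_restrict_mem measurableSet_Ioc] with x hx
  exact hC x (Ioc_subset_Icc_self hx)

theorem integral_mul_rpow_le {T : ℝ} (hT : 0 ≤ T) {g h : ℝ → ℝ} (hg : Continuous g)
    (hh : Continuous h) (hg0 : ∀ t, 0 ≤ g t) (hh0 : ∀ t, 0 ≤ h t) {j l : ℕ} (hl : 1 ≤ l)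
    (hj : j ≤ l) :
    ∫ t in (0:ℝ)..T, g t * h t ^ ((j : ℝ) / l) ≤
      (∫ t in (0:ℝ)..T, g t ^ (2 * (l : ℝ) / (2 * l - j))) ^ (1 / (2 * (l : ℝ) / (2 * l - j))) *
        Real.sqrt (∫ t in (0:ℝ)..T, h t ^ 2) ^ ((j : ℝ) / l) := by
  have hl0 : (0 : ℝ) < l := by exact_mod_cast hl
  have hjl : (j : ℝ) ≤ l := by exact_mod_cast hj
  rcases Nat.eq_zero_or_pos j with rfl | hj0
  · have : 2 * (l : ℝ) / (2 * l - (0 : ℕ)) = 1 := by field_simp; simp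
    rw [this]; simp
  have hj0' : (0 : ℝ) < j := by exact_mod_cast hj0
  have hpq : (2 * (l : ℝ) / (2 * l - j)).HolderConjugate (2 * l / j) := by
    have := Real.holderConjugate_one_div (a := (2 * l - j : ℝ) / (2 * l)) (b := j / (2 * l))
      (div_pos (by linarith) (by positivity)) (by positivity) (by field_simp; ring)
    simpa only [one_div_div] using this
  have hθ : Continuous fun t => h t ^ ((j : ℝ) / l) :=
    hh.rpow_const fun _ => Or.inr (by positivity)
  have H := integral_mul_le_Lp_mul_Lq_of_nonneg hpq (μ := volume.restrict (Ioc 0 T)) (f := g)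
    (g := fun t => h t ^ ((j : ℝ) / l)) (Filter.Eventually.of_forall hg0)
    (Filter.Eventually.of_forall fun t => Real.rpow_nonneg (hh0 t) _)
    (hg.memLp_restrict_Ioc _ _ _) (hθ.memLp_restrict_Ioc _ _ _)
  simp only [← intervalIntegral.integral_of_le hT] at H
  refine H.trans_eq ?_
  have e : ∀ t, (h t ^ ((j : ℝ) / l)) ^ (2 * (l : ℝ) / j) = h t ^ 2 := fun t => by
    rw [← Real.rpow_mul (hh0 t), ← Real.rpow_natCast]
    congr 1; push_cast; field_simp
  simp only [e]
  rw [Real.sqrt_eq_rpow, ← Real.rpow_mul (intervalIntegral.integral_nonneg hT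
    fun _ _ => sq_nonneg _)]
  congr 2; field_simp

theorem mixedNorm_eq {q R T : ℝ} (hR : 0 ≤ R) (F : ℝ → ℝ → ℝ) :
    mixedNorm q R T F = (∫ t in (0:ℝ)..T, l2Norm R (F t) ^ q) ^ (1 / q) := by
  have e : ∀ t, (∫ x in (0:ℝ)..R, F t x ^ 2) ^ (q / 2) = l2Norm R (F t) ^ q := fun t => by
    rw [← sq_l2Norm hR, ← Real.rpow_natCast, ← Real.rpow_mul (l2Norm_nonneg _ _)]
    congr 1; push_cast; ring
  simp only [mixedNorm, e]

theorem iSup_mem_le {s : Set ℝ} {φ : ℝ → ℝ} {M : ℝ} (hM : 0 ≤ M) (h : ∀ t ∈ s, φ t ≤ M) :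
    ⨆ t ∈ s, φ t ≤ M :=
  Real.iSup_le (fun t => Real.iSup_le (h t) hM) hM

/-- The source terms, paired with the solution, are controlled by `M + D`, where `M` bounds the
`L²` norm uniformly in time and `D` is the norm of the highest derivative. -/
theorem integral_source_le {T : ℝ} (hT : 0 ≤ T) {l : ℕ} (hl : 1 ≤ l) {n d φ : ℝ → ℝ}
    {g : ℕ → ℝ → ℝ} (hn : Continuous n) (hd : Continuous d) (hφ : Continuous φ)
    (hg : ∀ j ≤ l, Continuous (g j)) (hn0 : ∀ t, 0 ≤ n t) (hd0 : ∀ t, 0 ≤ d t)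
    (hφ0 : ∀ t, 0 ≤ φ t) (hg0 : ∀ j t, 0 ≤ g j t) {M : ℝ} (hM : ∀ t ∈ Icc 0 T, n t ≤ M) :
    ∫ t in (0:ℝ)..T, (φ t * n t + ∑ j ∈ Finset.range (l + 1),
        g j t * (n t ^ (1 - (j : ℝ) / l) * d t ^ ((j : ℝ) / l))) ≤
      ((∫ t in (0:ℝ)..T, φ t) + ∑ j ∈ Finset.range (l + 1),
        (∫ t in (0:ℝ)..T, g j t ^ (2 * (l : ℝ) / (2 * l - j))) ^
          (1 / (2 * (l : ℝ) / (2 * l - j)))) *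
        (M + Real.sqrt (∫ t in (0:ℝ)..T, d t ^ 2)) := by
  have hl0 : (0 : ℝ) < l := by exact_mod_cast hl
  have hM0 : 0 ≤ M := (hn0 0).trans (hM 0 ⟨le_rfl, hT⟩)
  set D := Real.sqrt (∫ t in (0:ℝ)..T, d t ^ 2)
  have hD0 : 0 ≤ D := Real.sqrt_nonneg _
  have hθ : ∀ j ∈ Finset.range (l + 1), 0 ≤ (j : ℝ) / l ∧ 0 ≤ 1 - (j : ℝ) / l := fun j hj => by
    have : (j : ℝ) ≤ l := by
      exact_mod_cast (by simpa [Nat.lt_succ_iff] using hj : j ≤ l)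
    exact ⟨by positivity, by rw [sub_nonneg, div_le_one hl0]; exact this⟩
  have hgc : ∀ j ∈ Finset.range (l + 1), Continuous (g j) := fun j hj =>
    hg j (by simpa [Nat.lt_succ_iff] using hj)
  have hc1 : ∀ j ∈ Finset.range (l + 1), Continuous fun t => d t ^ ((j : ℝ) / l) :=
    fun j hj => hd.rpow_const fun _ => Or.inr (hθ j hj).1
  have hc2 : ∀ j ∈ Finset.range (l + 1), Continuous fun t => n t ^ (1 - (j : ℝ) / l) :=
    fun j hj => hn.rpow_const fun _ => Or.inr (hθ j hj).2
  rw [intervalIntegral.integral_add, intervalIntegral.integral_finsetSum, add_mul, Finset.sum_mul]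
  · refine add_le_add ?_ (Finset.sum_le_sum fun j hj => ?_)
    · rw [← intervalIntegral.integral_mul_const]
      refine intervalIntegral.integral_mono_on hT (by apply Continuous.intervalIntegrable; fun_prop)
        (by apply Continuous.intervalIntegrable; fun_prop) fun t ht => ?_
      exact mul_le_mul_of_nonneg_left ((hM t ht).trans (by linarith)) (hφ0 t)
    · have hgj := hgc j hj
      have hdj := hc1 j hj
      have hnj := hc2 j hj
      obtain ⟨h1, h2⟩ := hθ j hj
      set N := (∫ t in (0:ℝ)..T, g j t ^ (2 * (l : ℝ) / (2 * l - j))) ^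
        (1 / (2 * (l : ℝ) / (2 * l - j)))
      have hN : 0 ≤ N := Real.rpow_nonneg (intervalIntegral.integral_nonneg hT
        fun t _ => Real.rpow_nonneg (hg0 j t) _) _
      calc ∫ t in (0:ℝ)..T, g j t * (n t ^ (1 - (j : ℝ) / l) * d t ^ ((j : ℝ) / l)) ≤
          ∫ t in (0:ℝ)..T, M ^ (1 - (j : ℝ) / l) * (g j t * d t ^ ((j : ℝ) / l)) := by
            refine intervalIntegral.integral_mono_on hT
              (by apply Continuous.intervalIntegrable; fun_prop)
              (by apply Continuous.intervalIntegrable; fun_prop) fun t ht => ?_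
            rw [mul_left_comm]
            exact mul_le_mul_of_nonneg_right (Real.rpow_le_rpow (hn0 t) (hM t ht) h2)
              (mul_nonneg (hg0 j t) (Real.rpow_nonneg (hd0 t) _))
        _ = M ^ (1 - (j : ℝ) / l) * ∫ t in (0:ℝ)..T, g j t * d t ^ ((j : ℝ) / l) :=
            intervalIntegral.integral_const_mul _ _
        _ ≤ (M + D) ^ (1 - (j : ℝ) / l) * (N * (M + D) ^ ((j : ℝ) / l)) := by
            have hH := integral_mul_rpow_le hT hgj hd (hg0 j) hd0 hl
              (by simpa [Nat.lt_succ_iff] using hj)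
            refine mul_le_mul (Real.rpow_le_rpow hM0 (by linarith) h2)
              (hH.trans (mul_le_mul_of_nonneg_left
                (Real.rpow_le_rpow hD0 (by linarith) h1) hN)) ?_ (by positivity)
            exact intervalIntegral.integral_nonneg hT fun t _ =>
              mul_nonneg (hg0 j t) (Real.rpow_nonneg (hd0 t) _)
        _ = N * (M + D) := by
            rw [mul_left_comm, ← Real.rpow_add_of_nonneg (by positivity) h2 h1]
            simp
  · intro j hj
    have hgj := hgc j hj
    have hdj := hc1 j hj
    have hnj := hc2 j hj
    apply Continuous.intervalIntegrable; fun_prop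
  · apply Continuous.intervalIntegrable; fun_prop
  · apply Continuous.intervalIntegrable
    refine continuous_finsetSum _ fun j hj => ?_
    have hgj := hgc j hj
    have hdj := hc1 j hj
    have hnj := hc2 j hj
    fun_prop

/-- The a priori estimate (2.6) of Lemma 2.2 of the paper, for smooth classical solutions
of the constant-coefficient linear equation with zero initial and boundary data. -/
theorem linear_apriori_estimate (l : ℕ) (hl : 1 ≤ l) (R T : ℝ) (hR : 0 < R) (hT : 0 < T)
    (a b : ℝ) (ha : 0 < a) (hb : b ≤ 0) :
    ∃ c : ℝ, 0 < c ∧ ∀ (f : ℝ → ℝ → ℝ) (G : ℕ → ℝ → ℝ → ℝ) (u : ℝ → ℝ → ℝ),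
      (ContDiff ℝ (⊤ : ℕ∞) fun p : ℝ × ℝ => f p.1 p.2) →
      (∀ j ≤ l, ContDiff ℝ (⊤ : ℕ∞) fun p : ℝ × ℝ => G j p.1 p.2) →
      (ContDiff ℝ (⊤ : ℕ∞) fun p : ℝ × ℝ => u p.1 p.2) →
      (∀ t ∈ Icc (0:ℝ) T, ∀ x ∈ Icc (0:ℝ) R,
        deriv (fun s => u s x) t -
            (-1 : ℝ) ^ l * (a * iteratedDeriv (2 * l + 1) (u t) x +
              b * iteratedDeriv (2 * l) (u t) x) =
          f t x + ∑ j ∈ Finset.range (l + 1), (-1 : ℝ) ^ j * iteratedDeriv j (G j t) x) →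
      (∀ x ∈ Icc (0:ℝ) R, u 0 x = 0) →
      (∀ t ∈ Icc (0:ℝ) T, ∀ j < l, iteratedDeriv j (u t) 0 = 0) →
      (∀ t ∈ Icc (0:ℝ) T, ∀ j ≤ l, iteratedDeriv j (u t) R = 0) →
      XNorm l R T u ≤
        c * ((∫ t in (0:ℝ)..T, Real.sqrt (∫ x in (0:ℝ)..R, (f t x) ^ 2)) +
          ∑ j ∈ Finset.range (l + 1),
            mixedNorm ((2 * (l : ℝ)) / (2 * (l : ℝ) - (j : ℝ))) R T (G j)) := by
  have hC : 0 < 2 * (1 + R + l * R) := by positivity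
  set C := 2 * (1 + R + l * R) with hCdef
  refine ⟨2 * C * (1 + 1 / a), by positivity, ?_⟩
  intro f G u hf hG hu heq hini hbc0 hbcR
  have hdc := contDiff_iteratedDeriv_snd hu l
  set n : ℝ → ℝ := fun t => l2Norm R (u t) with hn
  set d : ℝ → ℝ := fun t => l2Norm R (iteratedDeriv l (u t)) with hd
  set φ : ℝ → ℝ := fun t => l2Norm R (f t) with hφ
  set g : ℕ → ℝ → ℝ := fun j t => l2Norm R (G j t) with hg
  have hnc : Continuous n := continuous_l2Norm hu.continuous
  have hdc : Continuous d := continuous_l2Norm hdc.continuous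
  have hφc : Continuous φ := continuous_l2Norm hf.continuous
  have hgc : ∀ j ≤ l, Continuous (g j) := fun j hj => continuous_l2Norm (hG j hj).continuous
  obtain ⟨t₀, ht₀, hmax⟩ := (isCompact_Icc (a := (0:ℝ)) (b := T)).exists_isMaxOn
    ⟨0, le_rfl, hT.le⟩ hnc.continuousOn
  have hM : ∀ t ∈ Icc 0 T, n t ≤ n t₀ := hmax
  set D := Real.sqrt (∫ t in (0:ℝ)..T, d t ^ 2) with hD
  set S := (∫ t in (0:ℝ)..T, φ t) + ∑ j ∈ Finset.range (l + 1),
    (∫ t in (0:ℝ)..T, g j t ^ (2 * (l : ℝ) / (2 * l - j))) ^ (1 / (2 * (l : ℝ) / (2 * l - j)))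
    with hS
  set K : ℝ → ℝ := fun t => φ t * n t + ∑ j ∈ Finset.range (l + 1),
    g j t * (n t ^ (1 - (j : ℝ) / l) * d t ^ ((j : ℝ) / l)) with hK
  have hl0 : (0 : ℝ) < l := by exact_mod_cast hl
  have hKc : Continuous K := by
    refine (hφc.mul hnc).add (continuous_finsetSum _ fun j hj => ?_)
    have hj : j ≤ l := by simpa [Nat.lt_succ_iff] using hj
    have hj' : (j : ℝ) ≤ l := by exact_mod_cast hj
    refine (hgc j hj).mul ((hnc.rpow_const fun _ => Or.inr ?_).mul
      (hdc.rpow_const fun _ => Or.inr (by positivity)))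
    rw [sub_nonneg, div_le_one hl0]; exact hj'
  have hn0 : ∀ t, 0 ≤ n t := fun t => l2Norm_nonneg _ _
  have hd0 : ∀ t, 0 ≤ d t := fun t => l2Norm_nonneg _ _
  have hφ0 : ∀ t, 0 ≤ φ t := fun t => l2Norm_nonneg _ _
  have hg0 : ∀ j t, 0 ≤ g j t := fun j t => l2Norm_nonneg _ _
  have hK0 : ∀ t, 0 ≤ K t := fun t => add_nonneg (mul_nonneg (hφ0 t) (hn0 t))
    (Finset.sum_nonneg fun j _ => mul_nonneg (hg0 j t)
      (mul_nonneg (Real.rpow_nonneg (hn0 t) _) (Real.rpow_nonneg (hd0 t) _)))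
  have hKS : ∫ t in (0:ℝ)..T, K t ≤ S * (n t₀ + D) :=
    integral_source_le hT.le hl hnc hdc hφc hgc hn0 hd0 hφ0 hg0 hM
  have hutc : Continuous fun t =>
      ∫ x in (0:ℝ)..R, (1 + x) * (2 * u t x * deriv (fun r => u r x) t) := by
    have h1 := hu.continuous
    have h2 := (contDiff_deriv_fst hu).continuous
    apply intervalIntegral.continuous_parametric_intervalIntegral_of_continuous'
    change Continuous fun p : ℝ × ℝ => (1 + p.2) * (2 * u p.1 p.2 * deriv (fun r => u r p.2) p.1)
    fun_prop
  have henergy : ∀ τ ∈ Icc 0 T, n τ ^ 2 + a * ∫ t in (0:ℝ)..τ, d t ^ 2 ≤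
      C * (S * (n t₀ + D)) := by
    intro τ hτ
    have h1 : ∫ t in (0:ℝ)..τ,
        ((∫ x in (0:ℝ)..R, (1 + x) * (2 * u t x * deriv (fun r => u r x) t)) + a * d t ^ 2) ≤
        ∫ t in (0:ℝ)..τ, C * K t := by
      refine intervalIntegral.integral_mono_on hτ.1
        (by apply Continuous.intervalIntegrable; fun_prop)
        (by apply Continuous.intervalIntegrable; fun_prop) fun t ht => ?_
      have ht : t ∈ Icc 0 T := ⟨ht.1, ht.2.trans hτ.2⟩
      exact spatial_energy_inequality hR.le hl ha.le hb (w := fun x => deriv (fun r => u r x) t)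
        (contDiff_slice hf t).continuous (fun j hj => contDiff_slice (hG j hj) t)
        (contDiff_slice hu t) (heq t ht) (hbc0 t ht) (hbcR t ht)
    rw [intervalIntegral.integral_add (hutc.intervalIntegrable _ _)
      (by apply Continuous.intervalIntegrable; fun_prop), intervalIntegral.integral_const_mul,
      intervalIntegral.integral_const_mul, integral_integral_weight_mul_deriv hR.le hu hini] at h1
    have h2 : n τ ^ 2 ≤ ∫ x in (0:ℝ)..R, (1 + x) * u τ x ^ 2 := by
      have huc := (contDiff_slice hu τ).continuous
      rw [hn, sq_l2Norm hR.le]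
      refine intervalIntegral.integral_mono_on hR.le
        (by apply Continuous.intervalIntegrable; fun_prop)
        (by apply Continuous.intervalIntegrable; fun_prop) fun x hx => ?_
      nlinarith [sq_nonneg (u τ x), hx.1]
    have h3 : ∫ t in (0:ℝ)..τ, K t ≤ ∫ t in (0:ℝ)..T, K t :=
      intervalIntegral.integral_mono_interval le_rfl hτ.1 hτ.2
        (Filter.Eventually.of_forall hK0) (hKc.intervalIntegrable _ _)
    have h4 := mul_le_mul_of_nonneg_left (h3.trans hKS) hC.le
    linarith
  have hDsq : D ^ 2 = ∫ t in (0:ℝ)..T, d t ^ 2 :=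
    Real.sq_sqrt (intervalIntegral.integral_nonneg hT.le fun _ _ => sq_nonneg _)
  have hM2 : n t₀ ^ 2 ≤ C * (S * (n t₀ + D)) := by
    have h1 : 0 ≤ ∫ t in (0:ℝ)..t₀, d t ^ 2 :=
      intervalIntegral.integral_nonneg ht₀.1 fun _ _ => sq_nonneg _
    have := henergy t₀ ht₀
    nlinarith
  have hD2 : D ^ 2 ≤ 1 / a * (C * (S * (n t₀ + D))) := by
    have := henergy T ⟨hT.le, le_rfl⟩
    rw [← hDsq] at this
    rw [one_div, inv_mul_eq_div, le_div_iff₀ ha]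
    nlinarith [sq_nonneg (n T)]
  have hS0 : 0 ≤ S := by
    refine add_nonneg (intervalIntegral.integral_nonneg hT.le fun t _ => hφ0 t)
      (Finset.sum_nonneg fun j _ => Real.rpow_nonneg (intervalIntegral.integral_nonneg hT.le
        fun t _ => Real.rpow_nonneg (hg0 j t) _) _)
  have hD0 : 0 ≤ D := Real.sqrt_nonneg _
  have hX : n t₀ + D ≤ 2 * C * (1 + 1 / a) * S := by
    rcases (add_nonneg (hn0 t₀) hD0).eq_or_lt with h0 | h0
    · rw [← h0]; positivity
    · refine le_of_mul_le_mul_right ?_ h0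
      calc (n t₀ + D) * (n t₀ + D) ≤ 2 * (n t₀ ^ 2 + D ^ 2) := by
            nlinarith [sq_nonneg (n t₀ - D)]
        _ ≤ 2 * (C * (S * (n t₀ + D)) + 1 / a * (C * (S * (n t₀ + D)))) := by gcongr
        _ = _ := by ring
  calc XNorm l R T u ≤ n t₀ + D := by
        refine add_le_add (iSup_mem_le (hn0 t₀) hM) (le_of_eq ?_)
        rw [hD]
        simp only [hd, sq_l2Norm hR.le]
    _ ≤ _ := hX
    _ = _ := by
        simp only [hS, mixedNorm_eq hR.le]
        rfl
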